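/- Let g : ∂D → ℂ be integrable with respect to arclength on the boundary of the square D, with ∫_{∂D} |g(u)| log⁺(|g(u)|) |du| < ∞, and define f(z) = (1/(2πi)) ∮_{∂D} g(u)/(u − z) du for z ∈ D, where ∂D is traversed counterclockwise. Then f belongs to A²(Δ) + A²(π − Δ), i.e., there exist f₁ ∈ A²(Δ) and f₂ ∈ A²(π − Δ) with f = f₁|_D + f₂|_D. (Since every function in the Smirnov–Zygmund class E_{L log⁺L}(D) is the Cauchy integral of its boundary values, this says E_{L log⁺L}(D) ⊂ A²(Δ) + A²(π − Δ).) -/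

import Mathlib

open MeasureTheory Set

noncomputable section

/-- The open sector `Δ = {z : |arg z| < π/4}`. -/
def SectorDelta : Set ℂ := {z : ℂ | 0 < z.re ∧ |z.im| < z.re}

/-- The reflected sector `π − Δ`. -/
def SectorPiDelta : Set ℂ := (fun z => (Real.pi : ℂ) - z) '' SectorDelta

/-- The open square `D = Δ ∩ (π − Δ)` with vertices `0, π/2 − iπ/2, π, π/2 + iπ/2`. -/
def SquareD : Set ℂ := SectorDelta ∩ SectorPiDelta

/-- Membership in the Bergman space `A²(Ω)`. -/
def MemA2 (Ω : Set ℂ) (f : ℂ → ℂ) : Prop :=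
  DifferentiableOn ℂ f Ω ∧ ∫⁻ z in Ω, ENNReal.ofReal (‖f z‖ ^ 2) < ⊤

/-- Membership in the weighted Bergman space `A²(Ω, w)`. -/
def MemA2W (Ω : Set ℂ) (w : ℂ → ℝ) (f : ℂ → ℂ) : Prop :=
  DifferentiableOn ℂ f Ω ∧ ∫⁻ z in Ω, ENNReal.ofReal (‖f z‖ ^ 2 * w z) < ⊤

/-- `log⁺ t = max (log t) 0`. -/
def logPlus (t : ℝ) : ℝ := Real.log (max t 1)

/-- Starting vertices of the four sides of `∂D`, counterclockwise. -/
def sideStart : Fin 4 → ℂ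
  | 0 => 0
  | 1 => ((Real.pi / 2 : ℝ) : ℂ) * (1 - Complex.I)
  | 2 => ((Real.pi : ℝ) : ℂ)
  | 3 => ((Real.pi / 2 : ℝ) : ℂ) * (1 + Complex.I)

/-- Direction vectors of the four sides of `∂D`, counterclockwise. -/
def sideDir : Fin 4 → ℂ
  | 0 => ((Real.pi / 2 : ℝ) : ℂ) * (1 - Complex.I)
  | 1 => ((Real.pi / 2 : ℝ) : ℂ) * (1 + Complex.I)
  | 2 => ((Real.pi / 2 : ℝ) : ℂ) * (Complex.I - 1)
  | 3 => -(((Real.pi / 2 : ℝ) : ℂ) * (1 + Complex.I))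

/-- Parametrization of the `k`-th side of `∂D`. -/
def sidePath (k : Fin 4) (t : ℝ) : ℂ := sideStart k + (t : ℂ) * sideDir k

/-- `g` is arclength-integrable on `∂D` (each side has constant speed). -/
def BoundaryIntegrable (g : ℂ → ℂ) : Prop :=
  ∀ k : Fin 4, IntervalIntegrable (fun t => ‖g (sidePath k t)‖) volume 0 1

/-- `∫_{∂D} |g| log⁺|g| |du| < ∞` (each side has constant speed). -/
def BoundaryLlogL (g : ℂ → ℂ) : Prop :=
  ∀ k : Fin 4, IntervalIntegrable
    (fun t => ‖g (sidePath k t)‖ * logPlus ‖g (sidePath k t)‖) volume 0 1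

/-- The Cauchy integral `(1/(2πi)) ∮_{∂D} g(u)/(u − z) du`, `∂D` counterclockwise. -/
def cauchyD (g : ℂ → ℂ) (z : ℂ) : ℂ :=
  (2 * (Real.pi : ℂ) * Complex.I)⁻¹ *
    ∑ k : Fin 4, ∫ t in (0:ℝ)..1, g (sidePath k t) * sideDir k / (sidePath k t - z)

/-- The Cauchy transform `(𝒞g)(z) = (1/(iπ)) ∫_ℝ g(t)/(t − z) dt` on the upper half-plane. -/
def cauchyTransform (g : ℝ → ℂ) (z : ℂ) : ℂ :=
  (Complex.I * (Real.pi : ℂ))⁻¹ * ∫ t : ℝ, g t / ((t : ℂ) - z)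


/-! ### Elementary inequalities -/

lemma sz_young (a x : ℝ) (ha : 0 ≤ a) : a * x ≤ a * logPlus a + Real.exp x := by
  unfold logPlus
  set m := max a 1 with hm
  have hm1 : 1 ≤ m := le_max_right _ _
  have hma : a ≤ m := le_max_left _ _
  have hm0 : 0 < m := by linarith
  rcases le_total x (Real.log m) with h | h
  · have := mul_le_mul_of_nonneg_left h ha
    have := Real.exp_pos x
    linarith
  · have h1 : a * (x - Real.log m) ≤ m * (x - Real.log m) :=
      mul_le_mul_of_nonneg_right hma (by linarith)
    have h2 : x - Real.log m ≤ Real.exp (x - Real.log m) := by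
      have := Real.add_one_le_exp (x - Real.log m)
      linarith
    have h3 : m * Real.exp (x - Real.log m) = Real.exp x := by
      rw [Real.exp_sub, Real.exp_log hm0]
      field_simp
    have h4 : m * (x - Real.log m) ≤ Real.exp x := by
      rw [← h3]
      exact mul_le_mul_of_nonneg_left h2 hm0.le
    nlinarith

lemma sz_line (d S : ℝ) (hd : 0 < d) (hS : d ≤ S) :
    ∫⁻ r in Ioo (0:ℝ) S, ENNReal.ofReal ((max r d)⁻¹) ≤ ENNReal.ofReal (1 + Real.log (S / d)) := by
  have hsub : Ioo (0:ℝ) S ⊆ Ioc 0 d ∪ Ioc d S := by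
    intro r hr
    rcases le_or_gt r d with h | h
    · exact Or.inl ⟨hr.1, h⟩
    · exact Or.inr ⟨h, hr.2.le⟩
  have hlog : 0 ≤ Real.log (S / d) := Real.log_nonneg (by rw [le_div_iff₀ hd]; linarith)
  rw [ENNReal.ofReal_add zero_le_one hlog]
  refine (lintegral_mono_set hsub).trans ((lintegral_union_le _ _ _).trans (add_le_add ?_ ?_))
  · calc ∫⁻ r in Ioc (0:ℝ) d, ENNReal.ofReal ((max r d)⁻¹)
        ≤ ∫⁻ r in Ioc (0:ℝ) d, ENNReal.ofReal (d⁻¹) := by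
          refine setLIntegral_mono' measurableSet_Ioc fun r hr => ?_
          rw [max_eq_right hr.2]
      _ = ENNReal.ofReal 1 := by
          rw [setLIntegral_const, Real.volume_Ioc, sub_zero,
            ← ENNReal.ofReal_mul (by positivity), inv_mul_cancel₀ hd.ne']
  · have hint : IntegrableOn (fun r : ℝ => r⁻¹) (Ioc d S) := by
      have : IntervalIntegrable (fun r : ℝ => r⁻¹) volume d S := by
        apply intervalIntegral.intervalIntegrable_inv
        · intro x hx
          rw [uIcc_of_le hS] at hx
          linarith [hx.1]
        · exact continuousOn_id
      exact (intervalIntegrable_iff_integrableOn_Ioc_of_le hS).1 this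
    calc ∫⁻ r in Ioc d S, ENNReal.ofReal ((max r d)⁻¹)
        ≤ ∫⁻ r in Ioc d S, ENNReal.ofReal (r⁻¹) := by
          refine setLIntegral_mono' measurableSet_Ioc fun r hr => ?_
          rw [max_eq_left hr.1.le]
      _ = ENNReal.ofReal (∫ r in Ioc d S, r⁻¹) := by
          rw [ofReal_integral_eq_lintegral_ofReal hint]
          refine (ae_restrict_iff' measurableSet_Ioc).2 (Filter.Eventually.of_forall fun r hr => ?_)
          have : 0 < r := hd.trans hr.1
          show (0:ℝ) ≤ r⁻¹
          positivity
      _ = ENNReal.ofReal (Real.log (S / d)) := by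
          rw [← intervalIntegral.integral_of_le hS, integral_inv_of_pos hd (by linarith)]
      _ ≤ _ := le_rfl

lemma sz_radial (d S : ℝ) (hd : 0 < d) (hS : d ≤ S) :
    ∫⁻ z in Metric.ball (0:ℂ) S, ENNReal.ofReal (‖z‖⁻¹ * (max ‖z‖ d)⁻¹)
      ≤ ENNReal.ofReal (2 * Real.pi * (1 + Real.log (S / d))) := by
  rw [← lintegral_indicator measurableSet_ball, ← Complex.lintegral_comp_polarCoord_symm]
  have hlog : 0 ≤ Real.log (S / d) := Real.log_nonneg (by rw [le_div_iff₀ hd]; linarith)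
  calc _ ≤ ∫⁻ p in polarCoord.target,
          ((Ioo (0:ℝ) S).indicator (fun r => ENNReal.ofReal ((max r d)⁻¹)) p.1) * 1 := by
        refine setLIntegral_mono' polarCoord.open_target.measurableSet fun p hp => ?_
        have hp0 : 0 < p.1 := by
          rw [polarCoord_target] at hp
          exact hp.1
        have hn : ‖Complex.polarCoord.symm p‖ = p.1 := by
          rw [Complex.norm_polarCoord_symm, abs_of_pos hp0]
        by_cases h : p.1 < S
        · rw [indicator_of_mem, indicator_of_mem]
          · rw [hn, smul_eq_mul, ← ENNReal.ofReal_mul hp0.le, mul_one, ← mul_assoc,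
              mul_inv_cancel₀ hp0.ne', one_mul]
          · exact ⟨hp0, h⟩
          · rw [mem_ball_zero_iff, hn]; exact h
        · rw [indicator_of_notMem]
          · simp
          · rw [mem_ball_zero_iff, hn]; exact h
    _ = (∫⁻ r in Ioi (0:ℝ), (Ioo (0:ℝ) S).indicator (fun r => ENNReal.ofReal ((max r d)⁻¹)) r) *
          ∫⁻ _ in Ioo (-Real.pi) Real.pi, 1 := by
        rw [polarCoord_target, Measure.volume_eq_prod, ← Measure.prod_restrict]
        refine lintegral_prod_mul ?_ aemeasurable_const
        refine (Measurable.indicator ?_ measurableSet_Ioo).aemeasurable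
        fun_prop
    _ ≤ ENNReal.ofReal (1 + Real.log (S / d)) * ENNReal.ofReal (2 * Real.pi) := by
        gcongr
        · refine le_trans (setLIntegral_le_lintegral _ _) ?_
          rw [lintegral_indicator measurableSet_Ioo]
          exact sz_line d S hd hS
        · rw [setLIntegral_const, Real.volume_Ioo, one_mul]
          apply ENNReal.ofReal_le_ofReal
          linarith
    _ = _ := by
        rw [← ENNReal.ofReal_mul (by linarith)]
        congr 1
        ring

lemma sz_radial_center (p : ℂ) (d S : ℝ) (hd : 0 < d) (hS : d ≤ S) :
    ∫⁻ z in Metric.ball p S, ENNReal.ofReal (‖p - z‖⁻¹ * (max ‖p - z‖ d)⁻¹)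
      ≤ ENNReal.ofReal (2 * Real.pi * (1 + Real.log (S / d))) := by
  refine le_trans (le_of_eq ?_) (sz_radial d S hd hS)
  rw [← lintegral_indicator measurableSet_ball, ← lintegral_indicator measurableSet_ball,
    ← lintegral_sub_left_eq_self _ p]
  congr 1
  ext z
  by_cases h : z ∈ Metric.ball (0:ℂ) S
  · rw [indicator_of_mem h, indicator_of_mem]
    · simp
    · rw [mem_ball_zero_iff] at h
      simpa [dist_eq_norm] using h
  · rw [indicator_of_notMem h, indicator_of_notMem]
    rw [mem_ball_zero_iff] at h
    simpa [dist_eq_norm] using h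

/-- The kernel estimate. -/
lemma sz_kernel (p q : ℂ) (d : ℝ) (hd : 0 < d) (hd1 : d ≤ 105) (hpq : 2 * d ≤ ‖p - q‖)
    (hp : ‖p‖ ≤ 5) (hq : ‖q‖ ≤ 5) :
    ∫⁻ z in Metric.ball (0:ℂ) 100, ENNReal.ofReal (‖p - z‖⁻¹ * ‖q - z‖⁻¹)
      ≤ ENNReal.ofReal (4 * Real.pi * (1 + Real.log (105 / d))) := by
  have hlog : 0 ≤ Real.log (105 / d) := Real.log_nonneg (by rw [le_div_iff₀ hd]; linarith)
  have hball : ∀ p : ℂ, ‖p‖ ≤ 5 → Metric.ball (0:ℂ) 100 ⊆ Metric.ball p 105 := by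
    intro p hp
    apply Metric.ball_subset_ball'
    rw [dist_zero_left]
    linarith
  have key : ∀ p q z : ℂ, 2 * d ≤ ‖p - q‖ → ‖p - z‖ ≤ ‖q - z‖ →
      ‖p - z‖⁻¹ * ‖q - z‖⁻¹ ≤ ‖p - z‖⁻¹ * (max ‖p - z‖ d)⁻¹ := by
    intro p q z h1 h2
    have h3 : ‖p - q‖ ≤ ‖p - z‖ + ‖q - z‖ := by
      have : p - q = (p - z) - (q - z) := by ring
      rw [this]
      exact norm_sub_le _ _
    have h4 : max ‖p - z‖ d ≤ ‖q - z‖ := max_le h2 (by linarith)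
    have h5 : 0 < max ‖p - z‖ d := lt_max_of_lt_right hd
    gcongr
  calc _ ≤ ∫⁻ z in Metric.ball (0:ℂ) 100,
        (ENNReal.ofReal (‖p - z‖⁻¹ * (max ‖p - z‖ d)⁻¹) +
          ENNReal.ofReal (‖q - z‖⁻¹ * (max ‖q - z‖ d)⁻¹)) := by
        refine lintegral_mono fun z => ?_
        rcases le_total ‖p - z‖ ‖q - z‖ with h | h
        · exact (ENNReal.ofReal_le_ofReal (key p q z hpq h)).trans le_self_add
        · have := ENNReal.ofReal_le_ofReal (key q p z (by rwa [norm_sub_rev]) h)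
          rw [mul_comm] at this
          exact this.trans le_add_self
    _ = (∫⁻ z in Metric.ball (0:ℂ) 100, ENNReal.ofReal (‖p - z‖⁻¹ * (max ‖p - z‖ d)⁻¹)) +
          ∫⁻ z in Metric.ball (0:ℂ) 100, ENNReal.ofReal (‖q - z‖⁻¹ * (max ‖q - z‖ d)⁻¹) := by
        rw [lintegral_add_left]
        fun_prop
    _ ≤ ENNReal.ofReal (2 * Real.pi * (1 + Real.log (105 / d))) +
          ENNReal.ofReal (2 * Real.pi * (1 + Real.log (105 / d))) := by
        gcongr
        · exact (lintegral_mono_set (hball p hp)).trans (sz_radial_center p d 105 hd hd1)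
        · exact (lintegral_mono_set (hball q hq)).trans (sz_radial_center q d 105 hd hd1)
    _ = _ := by
        rw [← ENNReal.ofReal_add (by positivity) (by positivity)]
        congr 1
        ring

lemma sz_sqrt_sing : ∫⁻ t in Metric.ball (0:ℝ) 2, ENNReal.ofReal (|t| ^ (-(1/2):ℝ)) < ⊤ := by
  have h : IntegrableOn (fun t : ℝ => (fun r : ℝ => r ^ (-(1/2):ℝ)) ‖t‖) (Metric.ball (0:ℝ) 2) := by
    refine (integrableOn_fun_norm_addHaar volume (f := fun r : ℝ => r ^ (-(1/2):ℝ))).2 ?_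
    simp only [Module.finrank_self, Nat.sub_self, pow_zero, one_smul]
    have : IntervalIntegrable (fun r : ℝ => r ^ (-(1/2):ℝ)) volume 0 2 :=
      intervalIntegral.intervalIntegrable_rpow' (by norm_num)
    exact ((intervalIntegrable_iff_integrableOn_Ioo_of_le (by norm_num)).1 this)
  have h2 := h.2
  rw [hasFiniteIntegral_iff_ofReal] at h2
  · simpa using h2
  · exact Filter.Eventually.of_forall fun t => by positivity

lemma sz_sqrt_sing' (s : ℝ) (hs : s ∈ Icc (0:ℝ) 1) :
    ∫⁻ t in Ioc (0:ℝ) 1, ENNReal.ofReal (|t - s| ^ (-(1/2):ℝ)) ≤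
      ∫⁻ t in Metric.ball (0:ℝ) 2, ENNReal.ofReal (|t| ^ (-(1/2):ℝ)) := by
  rw [← lintegral_indicator measurableSet_ball, ← lintegral_indicator measurableSet_Ioc,
    ← lintegral_sub_right_eq_self (fun t => (Metric.ball (0:ℝ) 2).indicator _ t) s]
  refine lintegral_mono fun t => ?_
  by_cases h : t ∈ Ioc (0:ℝ) 1
  · rw [indicator_of_mem h, indicator_of_mem]
    rw [mem_ball_zero_iff, Real.norm_eq_abs, abs_lt]
    constructor <;> linarith [h.1, h.2, hs.1, hs.2]
  · rw [indicator_of_notMem h]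
    exact zero_le

/-- For a fixed point of the segment, the potential of the kernel is bounded. -/
lemma sz_potential (a b : ℂ) (hb : 1 ≤ ‖b‖) (hab : ∀ t ∈ Icc (0:ℝ) 1, ‖a + t * b‖ ≤ 5)
    (φ : ℝ → ℂ) (hφ : Measurable φ)
    (s : ℝ) (hs : s ∈ Icc (0:ℝ) 1) :
    ∫⁻ t in Ioc (0:ℝ) 1, ENNReal.ofReal ‖φ t‖ *
      ∫⁻ z in Metric.ball (0:ℂ) 100, ENNReal.ofReal (‖a + t * b - z‖⁻¹ * ‖a + s * b - z‖⁻¹) ≤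
    ENNReal.ofReal (8 * Real.pi) * ((∫⁻ t in Ioc (0:ℝ) 1, ENNReal.ofReal (‖φ t‖ * logPlus ‖φ t‖)) +
      ENNReal.ofReal (Real.exp ((1 + Real.log 210) / 2)) *
      ∫⁻ t in Metric.ball (0:ℝ) 2, ENNReal.ofReal (|t| ^ (-(1/2):ℝ))) := by
  have hlp : Measurable logPlus := by unfold logPlus; fun_prop
  calc _ ≤ ∫⁻ t in Ioc (0:ℝ) 1, ENNReal.ofReal (8 * Real.pi) *
        (ENNReal.ofReal (‖φ t‖ * logPlus ‖φ t‖) +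
          ENNReal.ofReal (Real.exp ((1 + Real.log 210) / 2)) *
            ENNReal.ofReal (|t - s| ^ (-(1/2):ℝ))) := by
        refine lintegral_mono_ae ?_
        have hne : ∀ᵐ t : ℝ ∂volume.restrict (Ioc (0:ℝ) 1), t ≠ s := by
          refine ae_restrict_of_ae ?_
          simp [ae_iff]
        filter_upwards [hne, ae_restrict_mem measurableSet_Ioc] with t hts ht
        have hτ : 0 < |t - s| := abs_pos.2 (sub_ne_zero.2 hts)
        have hτ1 : |t - s| ≤ 1 := by
          rw [abs_le]
          constructor <;> linarith [ht.1, ht.2, hs.1, hs.2]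
        have hk := sz_kernel (a + t * b) (a + s * b) (|t - s| / 2) (by positivity) (by linarith)
          (by
            have : a + t * b - (a + s * b) = ((t - s : ℝ) : ℂ) * b := by push_cast; ring
            rw [this, norm_mul, Complex.norm_real, Real.norm_eq_abs]
            nlinarith)
          (hab t ⟨ht.1.le, ht.2⟩) (hab s hs)
        refine (mul_le_mul_right hk _).trans ?_
        have h105 : 105 / (|t - s| / 2) = 210 / |t - s| := by field_simp; norm_num
        have hlp0 : 0 ≤ logPlus ‖φ t‖ := Real.log_nonneg (le_max_right _ _)
        rw [h105, ← ENNReal.ofReal_mul (norm_nonneg _), ← ENNReal.ofReal_mul (Real.exp_pos _).le,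
          ← ENNReal.ofReal_add (by positivity) (by positivity), ← ENNReal.ofReal_mul (by positivity)]
        apply ENNReal.ofReal_le_ofReal
        have hy := sz_young ‖φ t‖ ((1 + Real.log (210 / |t - s|)) / 2) (norm_nonneg _)
        have he : Real.exp ((1 + Real.log (210 / |t - s|)) / 2) =
            Real.exp ((1 + Real.log 210) / 2) * |t - s| ^ (-(1/2):ℝ) := by
          rw [Real.rpow_def_of_pos hτ, ← Real.exp_add, Real.log_div (by norm_num) hτ.ne']
          congr 1
          ring
        rw [← he]
        have := mul_le_mul_of_nonneg_left hy (show 0 ≤ 8 * Real.pi by positivity)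
        refine le_trans (le_of_eq ?_) this
        ring
    _ = ENNReal.ofReal (8 * Real.pi) * ((∫⁻ t in Ioc (0:ℝ) 1, ENNReal.ofReal (‖φ t‖ * logPlus ‖φ t‖)) +
      ENNReal.ofReal (Real.exp ((1 + Real.log 210) / 2)) *
      ∫⁻ t in Ioc (0:ℝ) 1, ENNReal.ofReal (|t - s| ^ (-(1/2):ℝ))) := by
        rw [lintegral_const_mul, lintegral_add_left, lintegral_const_mul] <;> fun_prop
    _ ≤ _ := by
        exact mul_le_mul_right (add_le_add le_rfl (mul_le_mul_right (sz_sqrt_sing' s hs) _)) _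

/-- The modulus potential of a segment. -/
def szU (a b : ℂ) (φ : ℝ → ℂ) (z : ℂ) : ENNReal :=
  ∫⁻ t in Ioc (0:ℝ) 1, ENNReal.ofReal (‖φ t‖ * ‖a + t * b - z‖⁻¹)

lemma szU_sq (a b : ℂ) (hb : 1 ≤ ‖b‖) (hab : ∀ t ∈ Icc (0:ℝ) 1, ‖a + t * b‖ ≤ 5)
    (φ : ℝ → ℂ) (hφ : Measurable φ) (hi : IntegrableOn φ (Ioc 0 1))
    (hl : IntegrableOn (fun t => ‖φ t‖ * logPlus ‖φ t‖) (Ioc 0 1)) :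
    ∫⁻ z in Metric.ball (0:ℂ) 100, szU a b φ z ^ 2 < ⊤ := by
  set C := ENNReal.ofReal (8 * Real.pi) *
    ((∫⁻ t in Ioc (0:ℝ) 1, ENNReal.ofReal (‖φ t‖ * logPlus ‖φ t‖)) +
      ENNReal.ofReal (Real.exp ((1 + Real.log 210) / 2)) *
      ∫⁻ t in Metric.ball (0:ℝ) 2, ENNReal.ofReal (|t| ^ (-(1/2):ℝ))) with hC
  have hCtop : C < ⊤ := by
    refine ENNReal.mul_lt_top ENNReal.ofReal_lt_top (ENNReal.add_lt_top.2 ⟨?_,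
      ENNReal.mul_lt_top ENNReal.ofReal_lt_top sz_sqrt_sing⟩)
    have h2 := hl.2
    rw [hasFiniteIntegral_iff_ofReal] at h2
    · exact h2
    · refine Filter.Eventually.of_forall fun t => ?_
      exact mul_nonneg (norm_nonneg _) (Real.log_nonneg (le_max_right _ _))
  have hm1 : ∀ z, Measurable fun t : ℝ => ENNReal.ofReal (‖φ t‖ * ‖a + t * b - z‖⁻¹) := by
    intro z; fun_prop
  calc ∫⁻ z in Metric.ball (0:ℂ) 100, szU a b φ z ^ 2
      = ∫⁻ z in Metric.ball (0:ℂ) 100, ∫⁻ s in Ioc (0:ℝ) 1, ∫⁻ t in Ioc (0:ℝ) 1,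
          ENNReal.ofReal (‖φ s‖ * ‖a + s * b - z‖⁻¹) * ENNReal.ofReal (‖φ t‖ * ‖a + t * b - z‖⁻¹) := by
        refine lintegral_congr fun z => ?_
        rw [lintegral_lintegral_mul (hm1 z).aemeasurable (hm1 z).aemeasurable, sq]
        rfl
    _ = ∫⁻ s in Ioc (0:ℝ) 1, ∫⁻ z in Metric.ball (0:ℂ) 100, ∫⁻ t in Ioc (0:ℝ) 1,
          ENNReal.ofReal (‖φ s‖ * ‖a + s * b - z‖⁻¹) * ENNReal.ofReal (‖φ t‖ * ‖a + t * b - z‖⁻¹) := by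
        refine lintegral_lintegral_swap (Measurable.aemeasurable ?_)
        refine Measurable.lintegral_prod_right'
          (f := fun p : (ℂ × ℝ) × ℝ => ENNReal.ofReal (‖φ p.1.2‖ * ‖a + p.1.2 * b - p.1.1‖⁻¹) *
            ENNReal.ofReal (‖φ p.2‖ * ‖a + p.2 * b - p.1.1‖⁻¹)) ?_
        fun_prop
    _ = ∫⁻ s in Ioc (0:ℝ) 1, ∫⁻ t in Ioc (0:ℝ) 1, ∫⁻ z in Metric.ball (0:ℂ) 100,
          ENNReal.ofReal (‖φ s‖ * ‖a + s * b - z‖⁻¹) * ENNReal.ofReal (‖φ t‖ * ‖a + t * b - z‖⁻¹) := by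
        refine lintegral_congr fun s => ?_
        refine lintegral_lintegral_swap (Measurable.aemeasurable ?_)
        simp only [Function.uncurry_def]
        fun_prop
    _ = ∫⁻ s in Ioc (0:ℝ) 1, ENNReal.ofReal ‖φ s‖ * ∫⁻ t in Ioc (0:ℝ) 1, ENNReal.ofReal ‖φ t‖ *
          ∫⁻ z in Metric.ball (0:ℂ) 100,
            ENNReal.ofReal (‖a + t * b - z‖⁻¹ * ‖a + s * b - z‖⁻¹) := by
        refine lintegral_congr fun s => ?_
        rw [← lintegral_const_mul' _ _ ENNReal.ofReal_ne_top]
        refine lintegral_congr fun t => ?_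
        rw [← lintegral_const_mul' _ _ ENNReal.ofReal_ne_top,
          ← lintegral_const_mul' _ _ ENNReal.ofReal_ne_top]
        refine lintegral_congr fun z => ?_
        rw [ENNReal.ofReal_mul (norm_nonneg _), ENNReal.ofReal_mul (norm_nonneg _),
          ENNReal.ofReal_mul (by positivity)]
        ring
    _ ≤ ∫⁻ s in Ioc (0:ℝ) 1, ENNReal.ofReal ‖φ s‖ * C := by
        refine setLIntegral_mono' measurableSet_Ioc fun s hs => ?_
        gcongr
        exact sz_potential a b hb hab φ hφ s ⟨hs.1.le, hs.2⟩
    _ = (∫⁻ s in Ioc (0:ℝ) 1, ENNReal.ofReal ‖φ s‖) * C := by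
        rw [lintegral_mul_const]
        fun_prop
    _ < ⊤ := by
        refine ENNReal.mul_lt_top ?_ hCtop
        have h2 := hi.2
        rwa [hasFiniteIntegral_iff_norm] at h2

/-- The Cauchy integral over a segment. -/
def szF (a b : ℂ) (φ : ℝ → ℂ) (z : ℂ) : ℂ :=
  ∫ t in (0:ℝ)..1, φ t * b / (a + t * b - z)

lemma szF_le (a b : ℂ) (φ : ℝ → ℂ) (z : ℂ) :
    ENNReal.ofReal ‖szF a b φ z‖ ≤ ENNReal.ofReal ‖b‖ * szU a b φ z := by
  unfold szF szU
  rw [intervalIntegral.integral_of_le zero_le_one, ofReal_norm,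
    ← lintegral_const_mul' _ _ ENNReal.ofReal_ne_top]
  refine (enorm_integral_le_lintegral_enorm _).trans (lintegral_mono fun t => ?_)
  show ‖φ t * b / (a + t * b - z)‖ₑ ≤ _
  rw [← ofReal_norm, ← ENNReal.ofReal_mul (norm_nonneg _)]
  apply ENNReal.ofReal_le_ofReal
  rw [norm_div, norm_mul, div_eq_mul_inv]
  apply le_of_eq
  ring

lemma szF_diff (a b : ℂ) (φ : ℝ → ℂ) (hφ : Measurable φ) (hi : IntegrableOn φ (Ioc 0 1))
    (z : ℂ) (hz : ∀ t ∈ Icc (0:ℝ) 1, a + t * b ≠ z) : DifferentiableAt ℂ (szF a b φ) z := by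
  have hcont : Continuous fun t : ℝ => ‖a + t * b - z‖ := by fun_prop
  obtain ⟨t₀, ht₀, hmin⟩ := isCompact_Icc.exists_isMinOn (s := Icc (0:ℝ) 1)
    ⟨0, by simp⟩ hcont.continuousOn
  set δ := ‖a + t₀ * b - z‖ with hδ
  have hδ0 : 0 < δ := norm_pos_iff.2 (sub_ne_zero.2 (hz t₀ ht₀))
  have hδm : ∀ t ∈ Icc (0:ℝ) 1, δ ≤ ‖a + t * b - z‖ := fun t ht => hmin ht
  have hlow : ∀ t ∈ Icc (0:ℝ) 1, ∀ x ∈ Metric.ball z (δ / 2), δ / 2 ≤ ‖a + t * b - x‖ := by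
    intro t ht x hx
    have h1 := hδm t ht
    have h2 : ‖x - z‖ < δ / 2 := by simpa [dist_eq_norm] using hx
    have h3 : a + t * b - z = (a + t * b - x) + (x - z) := by ring
    rw [h3] at h1
    have := norm_add_le (a + t * b - x) (x - z)
    linarith
  have hmem : ∀ᵐ t ∂(volume.restrict (Ioc (0:ℝ) 1)), t ∈ Ioc (0:ℝ) 1 :=
    ae_restrict_mem measurableSet_Ioc
  have key := hasDerivAt_integral_of_dominated_loc_of_deriv_le
    (μ := volume.restrict (Ioc (0:ℝ) 1)) (x₀ := z) (s := Metric.ball z (δ / 2))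
    (F := fun x t => φ t * b / (a + t * b - x))
    (F' := fun x t => φ t * b / (a + t * b - x) ^ 2)
    (bound := fun t => ‖φ t‖ * (‖b‖ / (δ / 2) ^ 2))
    (Metric.ball_mem_nhds z (by positivity))
    (Filter.Eventually.of_forall fun x => by
      apply Measurable.aestronglyMeasurable; fun_prop)
    (by
      refine Integrable.mono' (g := fun t => ‖φ t‖ * (‖b‖ / (δ / 2))) (hi.norm.mul_const _)
        (by apply Measurable.aestronglyMeasurable; fun_prop) ?_
      filter_upwards [hmem] with t ht
      rw [norm_div, norm_mul, mul_div_assoc]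
      have := hlow t ⟨ht.1.le, ht.2⟩ z (Metric.mem_ball_self (by positivity))
      gcongr)
    (by apply Measurable.aestronglyMeasurable; fun_prop)
    (by
      filter_upwards [hmem] with t ht x hx
      rw [norm_div, norm_mul, norm_pow, mul_div_assoc]
      have := hlow t ⟨ht.1.le, ht.2⟩ x hx
      gcongr)
    (hi.norm.mul_const _)
    (by
      filter_upwards [hmem] with t ht x hx
      have h0 : a + t * b - x ≠ 0 := by
        have := hlow t ⟨ht.1.le, ht.2⟩ x hx
        rw [← norm_pos_iff]
        linarith
      have h1 : HasDerivAt (fun x : ℂ => a + t * b - x) (-1) x := by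
        simpa using (hasDerivAt_id x).const_sub (a + t * b)
      have h2 := (h1.inv h0).const_mul (φ t * b)
      refine (h2.congr_deriv ?_).congr_of_eventuallyEq (Filter.Eventually.of_forall fun y => ?_)
      · rw [neg_neg, one_div, div_eq_mul_inv]
      · simp [div_eq_mul_inv])
  have h := key.2.differentiableAt
  have he : szF a b φ = fun x => ∫ t in Ioc (0:ℝ) 1, φ t * b / (a + t * b - x) := by
    ext x
    exact intervalIntegral.integral_of_le zero_le_one
  rw [he]
  exact h

/-- The total mass of a segment. -/
def szm (b : ℂ) (φ : ℝ → ℂ) : ℂ := ∫ t in (0:ℝ)..1, φ t * b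

lemma szF_far (a b : ℂ) (hab : ∀ t ∈ Icc (0:ℝ) 1, ‖a + t * b‖ ≤ 5)
    (φ : ℝ → ℂ) (hφ : Measurable φ) (hi : IntegrableOn φ (Ioc 0 1))
    (z : ℂ) (hz : 100 ≤ ‖z‖) :
    ‖szF a b φ z + szm b φ / z‖ ≤ (10 * ‖b‖ * ∫ t in Ioc (0:ℝ) 1, ‖φ t‖) / ‖z‖ ^ 2 := by
  have hz0 : 0 < ‖z‖ := by linarith
  have hzne : z ≠ 0 := norm_pos_iff.1 hz0
  have hlow : ∀ t ∈ Ioc (0:ℝ) 1, ‖z‖ / 2 ≤ ‖a + t * b - z‖ := by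
    intro t ht
    have h1 := hab t ⟨ht.1.le, ht.2⟩
    have h2 := norm_sub_norm_le z (a + t * b)
    rw [norm_sub_rev] at h2
    linarith
  have hint : Integrable (fun t : ℝ => φ t * b / (a + t * b - z)) (volume.restrict (Ioc (0:ℝ) 1)) := by
    refine Integrable.mono' (g := fun t => ‖φ t‖ * (‖b‖ / (‖z‖ / 2))) (hi.norm.mul_const _)
      (by apply Measurable.aestronglyMeasurable; fun_prop) ?_
    filter_upwards [ae_restrict_mem measurableSet_Ioc] with t ht
    rw [norm_div, norm_mul, mul_div_assoc]
    have := hlow t ht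
    gcongr
  unfold szF szm
  rw [intervalIntegral.integral_of_le zero_le_one, intervalIntegral.integral_of_le zero_le_one,
    ← integral_div, ← integral_add hint ((hi.mul_const b).div_const z)]
  have h := norm_integral_le_of_norm_le (μ := volume.restrict (Ioc (0:ℝ) 1))
    (f := fun t : ℝ => φ t * b / (a + t * b - z) + φ t * b / z)
    (g := fun t => ‖φ t‖ * (10 * ‖b‖ / ‖z‖ ^ 2)) (hi.norm.mul_const _) (by
      filter_upwards [ae_restrict_mem measurableSet_Ioc] with t ht
      have h1 := hlow t ht
      have h0 : a + t * b - z ≠ 0 := by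
        rw [← norm_pos_iff]
        linarith
      have he : φ t * b / (a + t * b - z) + φ t * b / z =
          φ t * (b * (a + t * b) / ((a + t * b - z) * z)) := by
        rw [div_add_div _ _ h0 hzne, ← mul_div_assoc]
        congr 1
        ring
      rw [he, norm_mul, norm_div, norm_mul, norm_mul]
      have h5 := hab t ⟨ht.1.le, ht.2⟩
      refine mul_le_mul_of_nonneg_left ?_ (norm_nonneg _)
      calc ‖b‖ * ‖a + t * b‖ / (‖a + t * b - z‖ * ‖z‖) ≤ ‖b‖ * 5 / (‖z‖ / 2 * ‖z‖) := by gcongr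
        _ = _ := by field_simp; ring)
  refine h.trans (le_of_eq ?_)
  rw [integral_mul_const]
  ring

/-! ### Assembling membership in the Bergman space -/

lemma sz_memA2 (S : Set ℂ) (hS : MeasurableSet S) (f : ℂ → ℂ) (hd : DifferentiableOn ℂ f S)
    (V : ℂ → ENNReal) (hV : ∫⁻ z in Metric.ball (0:ℂ) 100, V z < ⊤)
    (hfV : ∀ z ∈ S, ENNReal.ofReal (‖f z‖ ^ 2) ≤ V z) (C : ℝ)
    (hfar : ∀ z ∈ S, 100 ≤ ‖z‖ → ‖f z‖ ≤ C / ‖z‖ ^ 2) : MemA2 S f := by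
  refine ⟨hd, ?_⟩
  have hJ : ∫⁻ z : ℂ, ENNReal.ofReal ((1 + ‖z‖) ^ (-(4:ℝ))) < ⊤ :=
    finite_integral_one_add_norm (by simp [Complex.finrank_real_complex]; norm_num)
  have hsub : S ⊆ (Metric.ball (0:ℂ) 100 ∩ S) ∪ (S \ Metric.ball (0:ℂ) 100) := by
    intro z hz
    by_cases h : z ∈ Metric.ball (0:ℂ) 100
    · exact Or.inl ⟨h, hz⟩
    · exact Or.inr ⟨hz, h⟩
  refine lt_of_le_of_lt ((lintegral_mono_set hsub).trans (lintegral_union_le _ _ _))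
    (ENNReal.add_lt_top.2 ⟨?_, ?_⟩)
  · refine lt_of_le_of_lt ?_ hV
    refine (setLIntegral_mono' (measurableSet_ball.inter hS) fun z hz => hfV z hz.2).trans ?_
    exact lintegral_mono_set inter_subset_left
  · have : ∀ z ∈ S \ Metric.ball (0:ℂ) 100, ENNReal.ofReal (‖f z‖ ^ 2) ≤
        ENNReal.ofReal (16 * C ^ 2) * ENNReal.ofReal ((1 + ‖z‖) ^ (-(4:ℝ))) := by
      intro z hz
      have hz1 : 100 ≤ ‖z‖ := by simpa using hz.2
      have hf := hfar z hz.1 hz1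
      rw [← ENNReal.ofReal_mul (by positivity)]
      apply ENNReal.ofReal_le_ofReal
      have h4 : (1 + ‖z‖) ^ (-(4:ℝ)) = ((1 + ‖z‖) ^ 4)⁻¹ := by
        rw [Real.rpow_neg (by positivity)]
        norm_cast
      rw [h4]
      calc ‖f z‖ ^ 2 ≤ (C / ‖z‖ ^ 2) ^ 2 := by gcongr
        _ = 16 * C ^ 2 * ((2 * ‖z‖) ^ 4)⁻¹ := by
          have : ‖z‖ ≠ 0 := by linarith
          field_simp
          norm_num
        _ ≤ _ := by
          gcongr
          linarith
    refine lt_of_le_of_lt (setLIntegral_mono' (hS.diff measurableSet_ball) this) ?_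
    rw [lintegral_const_mul' _ _ ENNReal.ofReal_ne_top]
    exact ENNReal.mul_lt_top ENNReal.ofReal_lt_top
      ((setLIntegral_le_lintegral _ _).trans_lt hJ)

lemma sz_sq3 (x y w : ENNReal) : (x + y + w) ^ 2 ≤ 9 * x ^ 2 + 9 * y ^ 2 + 9 * w ^ 2 := by
  have key : ∀ m u : ENNReal, u ≤ 3 * m → u ^ 2 ≤ 9 * m ^ 2 := by
    intro m u h
    calc u ^ 2 ≤ (3 * m) ^ 2 := by gcongr
      _ = 9 * m ^ 2 := by rw [mul_pow]; norm_num
  have h3 : ∀ m : ENNReal, x ≤ m → y ≤ m → w ≤ m → x + y + w ≤ 3 * m := by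
    intro m h1 h2 h4
    calc x + y + w ≤ m + m + m := by gcongr
      _ = 3 * m := by ring
  rcases le_total x y with hxy | hxy
  · rcases le_total y w with hyw | hyw
    · exact (key w _ (h3 w (hxy.trans hyw) hyw le_rfl)).trans le_add_self
    · exact ((key y _ (h3 y hxy le_rfl hyw)).trans le_add_self).trans le_self_add
  · rcases le_total x w with hyw | hyw
    · exact (key w _ (h3 w hyw (hxy.trans hyw) le_rfl)).trans le_add_self
    · exact ((key x _ (h3 x le_rfl hxy hyw)).trans le_self_add).trans le_self_add

lemma sz_sector (S : Set ℂ) (hS : MeasurableSet S)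
    (a b : ℂ) (hb : 1 ≤ ‖b‖) (hab : ∀ t ∈ Icc (0:ℝ) 1, ‖a + t * b‖ ≤ 5)
    (hav : ∀ z ∈ S, ∀ t ∈ Icc (0:ℝ) 1, a + t * b ≠ z)
    (φ : ℝ → ℂ) (hφ : Measurable φ) (hi : IntegrableOn φ (Ioc 0 1))
    (hl : IntegrableOn (fun t => ‖φ t‖ * logPlus ‖φ t‖) (Ioc 0 1))
    (a' b' : ℂ) (hb' : 1 ≤ ‖b'‖) (hab' : ∀ t ∈ Icc (0:ℝ) 1, ‖a' + t * b'‖ ≤ 5)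
    (hav' : ∀ z ∈ S, ∀ t ∈ Icc (0:ℝ) 1, a' + t * b' ≠ z)
    (φ' : ℝ → ℂ) (hφ' : Measurable φ') (hi' : IntegrableOn φ' (Ioc 0 1))
    (hl' : IntegrableOn (fun t => ‖φ' t‖ * logPlus ‖φ' t‖) (Ioc 0 1))
    (κ : ℂ) (G : ℂ → ℂ) (hG : DifferentiableOn ℂ G S) (B C : ℝ)
    (hGB : ∀ z ∈ S, ‖G z‖ ≤ B)
    (hGC : ∀ z ∈ S, 100 ≤ ‖z‖ → ‖G z - κ * (szm b φ + szm b' φ') / z‖ ≤ C / ‖z‖ ^ 2) :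
    MemA2 S (fun z => κ * (szF a b φ z + szF a' b' φ' z) + G z) := by
  refine sz_memA2 S hS _ ?_
    (fun z => 9 * (ENNReal.ofReal (‖κ‖ * ‖b‖) * szU a b φ z) ^ 2 +
      9 * (ENNReal.ofReal (‖κ‖ * ‖b'‖) * szU a' b' φ' z) ^ 2 + 9 * (ENNReal.ofReal B) ^ 2)
    ?_ ?_ (‖κ‖ * (10 * ‖b‖ * ∫ t in Ioc (0:ℝ) 1, ‖φ t‖) +
      ‖κ‖ * (10 * ‖b'‖ * ∫ t in Ioc (0:ℝ) 1, ‖φ' t‖) + C) ?_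
  · intro z hz
    have h1 := szF_diff a b φ hφ hi z (hav z hz)
    have h2 := szF_diff a' b' φ' hφ' hi' z (hav' z hz)
    exact (((h1.add h2).const_mul κ).differentiableWithinAt).add (hG z hz)
  · have hU := szU_sq a b hb hab φ hφ hi hl
    have hU' := szU_sq a' b' hb' hab' φ' hφ' hi' hl'
    have hB : ∫⁻ z in Metric.ball (0:ℂ) 100, 9 * (ENNReal.ofReal B) ^ 2 < ⊤ := by
      rw [setLIntegral_const]
      refine ENNReal.mul_lt_top (ENNReal.mul_lt_top (by norm_num) ?_) measure_ball_lt_top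
      exact ENNReal.pow_lt_top ENNReal.ofReal_lt_top
    rw [lintegral_add_right _ measurable_const]
    refine ENNReal.add_lt_top.2 ⟨?_, hB⟩
    have hm : ∀ (a b : ℂ) (φ : ℝ → ℂ), Measurable φ → Measurable (szU a b φ) := by
      intro a b φ hφ
      unfold szU
      refine Measurable.lintegral_prod_right'
        (f := fun p : ℂ × ℝ => ENNReal.ofReal (‖φ p.2‖ * ‖a + p.2 * b - p.1‖⁻¹)) ?_
      fun_prop
    have hm1 := hm a b φ hφ
    rw [lintegral_add_left (by fun_prop)]
    simp only [mul_pow, ← mul_assoc]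
    have hc : ∀ x : ℝ, 9 * ENNReal.ofReal x ^ 2 < ⊤ := fun x =>
      ENNReal.mul_lt_top (by norm_num) (ENNReal.pow_lt_top ENNReal.ofReal_lt_top)
    rw [lintegral_const_mul' _ _ (hc _).ne, lintegral_const_mul' _ _ (hc _).ne]
    exact ENNReal.add_lt_top.2 ⟨ENNReal.mul_lt_top (hc _) hU, ENNReal.mul_lt_top (hc _) hU'⟩
  · intro z hz
    rw [ENNReal.ofReal_pow (norm_nonneg _)]
    refine le_trans ?_ (sz_sq3 _ _ _)
    gcongr
    have h1 : ‖κ * (szF a b φ z + szF a' b' φ' z) + G z‖ ≤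
        ‖κ‖ * ‖szF a b φ z‖ + ‖κ‖ * ‖szF a' b' φ' z‖ + B := by
      refine (norm_add_le _ _).trans (add_le_add ?_ (hGB z hz))
      rw [norm_mul, ← mul_add]
      exact mul_le_mul_of_nonneg_left (norm_add_le _ _) (norm_nonneg _)
    refine (ENNReal.ofReal_le_ofReal h1).trans (ENNReal.ofReal_add_le.trans ?_)
    refine add_le_add (ENNReal.ofReal_add_le.trans (add_le_add ?_ ?_)) le_rfl
    · rw [ENNReal.ofReal_mul (norm_nonneg _), ENNReal.ofReal_mul (norm_nonneg _), mul_assoc]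
      exact mul_le_mul_right (szF_le _ _ _ _) _
    · rw [ENNReal.ofReal_mul (norm_nonneg _), ENNReal.ofReal_mul (norm_nonneg _), mul_assoc]
      exact mul_le_mul_right (szF_le _ _ _ _) _
  · intro z hz hz1
    have h1 := szF_far a b hab φ hφ hi z hz1
    have h2 := szF_far a' b' hab' φ' hφ' hi' z hz1
    have h3 := hGC z hz hz1
    have he : κ * (szF a b φ z + szF a' b' φ' z) + G z =
        κ * (szF a b φ z + szm b φ / z) + κ * (szF a' b' φ' z + szm b' φ' / z) +
          (G z - κ * (szm b φ + szm b' φ') / z) := by ring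
    show ‖κ * (szF a b φ z + szF a' b' φ' z) + G z‖ ≤ _
    rw [he]
    refine (norm_add_le _ _).trans ?_
    rw [add_div _ C, add_div (‖κ‖ * _), mul_div_assoc ‖κ‖, mul_div_assoc ‖κ‖]
    refine add_le_add ((norm_add_le _ _).trans (add_le_add ?_ ?_)) h3
    · rw [norm_mul]
      exact mul_le_mul_of_nonneg_left h1 (norm_nonneg _)
    · rw [norm_mul]
      exact mul_le_mul_of_nonneg_left h2 (norm_nonneg _)

/-! ### The corrector functions -/

lemma sz_memDelta (z : ℂ) : z ∈ SectorDelta ↔ |z.im| < z.re := by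
  unfold SectorDelta
  constructor
  · exact fun h => h.2
  · exact fun h => ⟨(abs_nonneg _).trans_lt h, h⟩

lemma sz_memPiDelta (z : ℂ) : z ∈ SectorPiDelta ↔ |z.im| < Real.pi - z.re := by
  unfold SectorPiDelta
  constructor
  · rintro ⟨w, hw, rfl⟩
    rw [sz_memDelta] at hw
    simpa using hw
  · intro h
    refine ⟨Real.pi - z, ?_, by simp⟩
    rw [sz_memDelta]
    simpa using h

lemma sz_measDelta : MeasurableSet SectorDelta := by
  have : SectorDelta = {z : ℂ | |z.im| < z.re} := by
    ext z
    exact sz_memDelta z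
  rw [this]
  exact measurableSet_lt (by fun_prop) (by fun_prop)

lemma sz_measPiDelta : MeasurableSet SectorPiDelta := by
  have : SectorPiDelta = {z : ℂ | |z.im| < Real.pi - z.re} := by
    ext z
    exact sz_memPiDelta z
  rw [this]
  exact measurableSet_lt (by fun_prop) (by fun_prop)

/-- Both sectors avoid the neighbourhoods of `± 10 i` and the vertical half-lines. -/
def szP (z : ℂ) : Prop := |z.im| < z.re ∨ |z.im| < Real.pi - z.re

lemma szP_norm (z : ℂ) (h : szP z) (w : ℂ) (hw : w.re = 0) (hw' : w.im = 10 ∨ w.im = -10) :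
    1 ≤ ‖z - w‖ := by
  by_contra hlt
  push Not at hlt
  have h1 := (Complex.abs_re_le_norm (z - w)).trans_lt hlt
  have h2 := (Complex.abs_im_le_norm (z - w)).trans_lt hlt
  rw [Complex.sub_re, abs_lt] at h1
  rw [Complex.sub_im, abs_lt] at h2
  have hpi := Real.pi_lt_four
  have h3 : 9 < |z.im| := by
    rw [lt_abs]
    rcases hw' with e | e <;> rw [e] at h2
    · left; linarith
    · right; linarith
  rcases h with h | h <;> linarith

lemma szP_slit (z : ℂ) (h : szP z) : z ^ 2 + 100 ∈ Complex.slitPlane := by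
  rw [Complex.mem_slitPlane_iff]
  by_contra hcon
  push Not at hcon
  obtain ⟨h1, h2⟩ := hcon
  have hpi := Real.pi_lt_four
  have e1 : (z ^ 2 + 100).re = z.re ^ 2 - z.im ^ 2 + 100 := by
    simp [sq]
  have e2 : (z ^ 2 + 100).im = 2 * (z.re * z.im) := by
    simp [sq]; ring
  rw [e1] at h1
  rw [e2] at h2
  have h3 : z.re * z.im = 0 := by linarith
  rcases mul_eq_zero.1 h3 with h0 | h0
  · have h4 : |z.im| < 4 := by
      rcases h with h | h <;> rw [h0] at h <;> linarith
    rw [abs_lt] at h4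
    rw [h0] at h1
    nlinarith
  · rw [h0] at h1
    nlinarith

/-- The square root `√(z² + 100)`. -/
def szs (z : ℂ) : ℂ := (z ^ 2 + 100) ^ ((2:ℕ):ℂ)⁻¹

lemma szs_sq (z : ℂ) : szs z ^ 2 = z ^ 2 + 100 :=
  Complex.cpow_nat_inv_pow _ two_ne_zero

lemma szs_re (z : ℂ) : 0 ≤ (szs z).re := by
  unfold szs
  by_cases h : z ^ 2 + 100 = 0
  · rw [h, Complex.zero_cpow (by norm_num)]
    simp
  · rw [Complex.cpow_def_of_ne_zero h, Complex.exp_re]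
    refine mul_nonneg (Real.exp_pos _).le (Real.cos_nonneg_of_mem_Icc ?_)
    have h1 := Complex.neg_pi_lt_arg (z ^ 2 + 100)
    have h2 := Complex.arg_le_pi (z ^ 2 + 100)
    have : (Complex.log (z ^ 2 + 100) * ((2:ℕ):ℂ)⁻¹).im = Complex.arg (z ^ 2 + 100) / 2 := by
      have e : ((2:ℕ):ℂ)⁻¹ = (((2:ℝ)⁻¹ : ℝ) : ℂ) := by push_cast; rfl
      rw [e, Complex.im_mul_ofReal, Complex.log_im]
      rfl
    rw [this]
    constructor <;> linarith

lemma szs_norm (z : ℂ) (h : szP z) : 1 ≤ ‖szs z‖ := by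
  have h1 := szP_norm z h (10 * Complex.I) (by simp) (by simp)
  have h2 := szP_norm z h (-(10 * Complex.I)) (by simp) (by simp)
  have h3 : ‖szs z‖ ^ 2 = ‖z - 10 * Complex.I‖ * ‖z - -(10 * Complex.I)‖ := by
    rw [← norm_pow, szs_sq, ← norm_mul]
    congr 1
    ring_nf
    rw [Complex.I_sq]
    ring
  have h4 := norm_nonneg (szs z)
  nlinarith

lemma szs_far (z s : ℂ) (hs : s ^ 2 = z ^ 2 + 100) (hz : 100 ≤ ‖z‖) (h : ‖z‖ ≤ 3 * ‖s + z‖) :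
    ‖1 / s - 1 / z‖ ≤ 6 / ‖z‖ ^ 2 := by
  have hz0 : 0 < ‖z‖ := by linarith
  have hs2 : ‖z‖ / 2 ≤ ‖s‖ := by
    have h1 : ‖z‖ ^ 2 - 100 ≤ ‖s‖ ^ 2 := by
      rw [← norm_pow s, hs]
      have := norm_sub_norm_le (z ^ 2) (-100)
      rw [norm_neg, norm_pow, sub_neg_eq_add] at this
      have e : ‖(100:ℂ)‖ = 100 := by simp
      rw [e] at this
      exact this
    have := norm_nonneg s
    nlinarith
  have hsne : s ≠ 0 := by
    rw [← norm_pos_iff]; linarith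
  have hzne : z ≠ 0 := norm_pos_iff.1 hz0
  have hszne : s + z ≠ 0 := by
    rw [← norm_pos_iff]; linarith
  have he : 1 / s - 1 / z = -100 / (s * z * (s + z)) := by
    rw [div_sub_div _ _ hsne hzne, div_eq_div_iff (mul_ne_zero hsne hzne)
      (mul_ne_zero (mul_ne_zero hsne hzne) hszne)]
    linear_combination (-(s * z)) * hs
  have h3 : ‖z‖ / 3 ≤ ‖s + z‖ := by linarith
  rw [he, norm_div, norm_mul, norm_mul, norm_neg]
  have e : ‖(100:ℂ)‖ = 100 := by simp
  rw [e]
  calc 100 / (‖s‖ * ‖z‖ * ‖s + z‖) ≤ 100 / (‖z‖ / 2 * 100 * (‖z‖ / 3)) := by gcongr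
    _ = _ := by field_simp; norm_num

lemma szq_far (z : ℂ) (hz : 100 ≤ ‖z‖) : ‖1 / (z - 10 * Complex.I) - 1 / z‖ ≤ 20 / ‖z‖ ^ 2 := by
  have hz0 : 0 < ‖z‖ := by linarith
  have hzne : z ≠ 0 := norm_pos_iff.1 hz0
  have e : ‖10 * Complex.I‖ = 10 := by simp
  have h1 : ‖z‖ / 2 ≤ ‖z - 10 * Complex.I‖ := by
    have := norm_sub_norm_le z (10 * Complex.I)
    rw [e] at this
    linarith
  have hne : z - 10 * Complex.I ≠ 0 := by
    rw [← norm_pos_iff]; linarith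
  have he : 1 / (z - 10 * Complex.I) - 1 / z = 10 * Complex.I / ((z - 10 * Complex.I) * z) := by
    rw [div_sub_div _ _ hne hzne]
    congr 1
    ring
  rw [he, norm_div, norm_mul (z - 10 * Complex.I), e]
  calc 10 / (‖z - 10 * Complex.I‖ * ‖z‖) ≤ 10 / (‖z‖ / 2 * ‖z‖) := by gcongr
    _ = _ := by field_simp; norm_num

/-- Corrector behaving like `1/z` on the right. -/
def szhp (z : ℂ) : ℂ := (1 / (z - 10 * Complex.I) + 1 / szs z) / 2

/-- Corrector behaving like `1/z` on the left. -/
def szhm (z : ℂ) : ℂ := (1 / (z - 10 * Complex.I) - 1 / szs z) / 2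

lemma szP_ne (z : ℂ) (h : szP z) : z - 10 * Complex.I ≠ 0 ∧ szs z ≠ 0 := by
  have h1 := szP_norm z h (10 * Complex.I) (by simp) (by simp)
  have h2 := szs_norm z h
  constructor
  · rw [← norm_pos_iff]; linarith
  · rw [← norm_pos_iff]; linarith

lemma szs_diff (z : ℂ) (h : szP z) : DifferentiableAt ℂ szs z := by
  unfold szs
  refine DifferentiableAt.cpow (by fun_prop) (by fun_prop) (szP_slit z h)

lemma szhp_diff (z : ℂ) (h : szP z) : DifferentiableAt ℂ szhp z := by
  have h1 := szs_diff z h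
  obtain ⟨h2, h3⟩ := szP_ne z h
  have h4 : DifferentiableAt ℂ (fun z : ℂ => 1 / (z - 10 * Complex.I)) z :=
    (differentiableAt_const (1:ℂ)).div (by fun_prop) h2
  have h5 : DifferentiableAt ℂ (fun z : ℂ => 1 / szs z) z :=
    (differentiableAt_const (1:ℂ)).div h1 h3
  exact (h4.add h5).div_const 2

lemma szhm_diff (z : ℂ) (h : szP z) : DifferentiableAt ℂ szhm z := by
  have h1 := szs_diff z h
  obtain ⟨h2, h3⟩ := szP_ne z h
  have h4 : DifferentiableAt ℂ (fun z : ℂ => 1 / (z - 10 * Complex.I)) z :=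
    (differentiableAt_const (1:ℂ)).div (by fun_prop) h2
  have h5 : DifferentiableAt ℂ (fun z : ℂ => 1 / szs z) z :=
    (differentiableAt_const (1:ℂ)).div h1 h3
  exact (h4.sub h5).div_const 2

lemma szh_bd (z : ℂ) (h : szP z) : ‖szhp z‖ ≤ 1 ∧ ‖szhm z‖ ≤ 1 := by
  have h1 := szP_norm z h (10 * Complex.I) (by simp) (by simp)
  have h2 := szs_norm z h
  have h3 : ‖1 / (z - 10 * Complex.I)‖ ≤ 1 := by
    rw [norm_div, norm_one]
    exact div_le_one_of_le₀ h1 (norm_nonneg _)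
  have h4 : ‖1 / szs z‖ ≤ 1 := by
    rw [norm_div, norm_one]
    exact div_le_one_of_le₀ h2 (norm_nonneg _)
  have h5 := norm_add_le (1 / (z - 10 * Complex.I)) (1 / szs z)
  have h6 := norm_sub_le (1 / (z - 10 * Complex.I)) (1 / szs z)
  have e : ‖(2:ℂ)‖ = 2 := by simp
  unfold szhp szhm
  rw [norm_div, norm_div, e]
  constructor <;> linarith

lemma sz_half (x y : ℂ) (d : ℝ) (hx : ‖x‖ ≤ 20 / d) (hy : ‖y‖ ≤ 6 / d) :
    ‖(x + y) / 2‖ ≤ 13 / d ∧ ‖(x - y) / 2‖ ≤ 13 / d := by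
  have h5 := norm_add_le x y
  have h6 := norm_sub_le x y
  have e : ‖(2:ℂ)‖ = 2 := by simp
  have e' : 13 / d = (20 / d + 6 / d) / 2 := by ring
  rw [norm_div, norm_div, e, e']
  constructor <;> linarith

lemma szh_right (z : ℂ) (h : z ∈ SectorDelta) (hz : 100 ≤ ‖z‖) :
    ‖szhp z - 1 / z‖ ≤ 13 / ‖z‖ ^ 2 ∧ ‖szhm z‖ ≤ 13 / ‖z‖ ^ 2 := by
  rw [sz_memDelta] at h
  have h0 := szs_re z
  have hr : 0 ≤ z.re := (abs_nonneg _).trans h.le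
  have hn := Complex.norm_le_abs_re_add_abs_im z
  rw [abs_of_nonneg hr] at hn
  have h1 : z.re ≤ ‖szs z + z‖ := by
    have := Complex.re_le_norm (szs z + z)
    rw [Complex.add_re] at this
    linarith
  have h2 := szs_far z (szs z) (szs_sq z) hz (by linarith)
  have h3 := sz_half _ _ _ (szq_far z hz) h2
  constructor
  · convert h3.1 using 2
    unfold szhp
    ring
  · convert h3.2 using 2
    unfold szhm
    ring

lemma szh_left (z : ℂ) (h : z ∈ SectorPiDelta) (hz : 100 ≤ ‖z‖) :
    ‖szhm z - 1 / z‖ ≤ 13 / ‖z‖ ^ 2 ∧ ‖szhp z‖ ≤ 13 / ‖z‖ ^ 2 := by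
  rw [sz_memPiDelta] at h
  have h0 := szs_re z
  have hpi := Real.pi_lt_four
  have hn := Complex.norm_le_abs_re_add_abs_im z
  have hr : z.re ≤ 0 := by
    by_contra hc
    push Not at hc
    have := abs_nonneg z.im
    rw [abs_of_pos hc] at hn
    linarith
  rw [abs_of_nonpos hr] at hn
  have h1 : -z.re ≤ ‖szs z + -z‖ := by
    have := Complex.re_le_norm (szs z + -z)
    rw [Complex.add_re, Complex.neg_re] at this
    linarith
  have h2 := szs_far (-z) (szs z) (by rw [szs_sq]; ring) (by rwa [norm_neg])
    (by rw [norm_neg]; linarith)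
  rw [norm_neg] at h2
  have h3 := sz_half _ _ _ (szq_far z hz) h2
  constructor
  · convert h3.2 using 2
    unfold szhm
    rw [div_neg]
    ring
  · convert h3.1 using 2
    unfold szhp
    rw [div_neg]
    ring

/-! ### The boundary data -/

lemma sz_rep (a b : ℂ) (hb : b ≠ 0) (γ : ℝ → ℂ)
    (h1 : IntervalIntegrable (fun t => ‖γ t‖) volume 0 1)
    (h2 : IntervalIntegrable (fun t => ‖γ t‖ * logPlus ‖γ t‖) volume 0 1) :
    ∃ φ : ℝ → ℂ, Measurable φ ∧ IntegrableOn φ (Ioc 0 1) ∧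
      IntegrableOn (fun t => ‖φ t‖ * logPlus ‖φ t‖) (Ioc 0 1) ∧
      ∀ z, (∀ t ∈ Icc (0:ℝ) 1, a + t * b ≠ z) →
        ∫ t in (0:ℝ)..1, γ t * b / (a + t * b - z) = szF a b φ z := by
  rw [intervalIntegrable_iff_integrableOn_Ioc_of_le zero_le_one] at h1 h2
  by_cases hm : AEStronglyMeasurable γ (volume.restrict (Ioc (0:ℝ) 1))
  · have hae := hm.ae_eq_mk
    refine ⟨hm.mk γ, hm.stronglyMeasurable_mk.measurable, ?_, ?_, ?_⟩
    · exact ((integrable_norm_iff hm).1 h1).congr hae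
    · refine h2.congr ?_
      filter_upwards [hae] with t ht
      rw [ht]
    · intro z _
      unfold szF
      rw [intervalIntegral.integral_of_le zero_le_one, intervalIntegral.integral_of_le zero_le_one]
      refine integral_congr_ae ?_
      filter_upwards [hae] with t ht
      rw [ht]
  · refine ⟨fun _ => 0, measurable_const, integrableOn_zero, by simp, ?_⟩
    intro z hz
    have : szF a b (fun _ => 0) z = 0 := by simp [szF]
    rw [this, intervalIntegral.integral_of_le zero_le_one]
    apply integral_undef
    intro hint
    apply hm
    have hme : AEStronglyMeasurable (fun t : ℝ => (a + t * b - z) / b)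
        (volume.restrict (Ioc (0:ℝ) 1)) := by
      apply Measurable.aestronglyMeasurable
      fun_prop
    refine (hint.aestronglyMeasurable.mul hme).congr ?_
    filter_upwards [ae_restrict_mem measurableSet_Ioc] with t ht
    have h0 : a + t * b - z ≠ 0 := sub_ne_zero.2 (hz t ⟨ht.1.le, ht.2⟩)
    show γ t * b / (a + t * b - z) * ((a + t * b - z) / b) = γ t
    rw [div_mul_div_cancel₀ h0, mul_div_cancel_right₀ _ hb]

lemma sz_side (k : Fin 4) (t : ℝ) :
    ((sideStart k + t * sideDir k).re = ![t, 1 + t, 2 - t, 1 - t] k * (Real.pi / 2)) ∧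
    ((sideStart k + t * sideDir k).im = ![-t, t - 1, t, 1 - t] k * (Real.pi / 2)) := by
  fin_cases k
  all_goals
    simp [sideStart, sideDir]
    try constructor
  all_goals ring_nf

lemma sz_dir (k : Fin 4) : 1 ≤ ‖sideDir k‖ := by
  have hpi := Real.pi_gt_three
  have h := Complex.abs_re_le_norm (sideDir k)
  refine le_trans ?_ h
  have : |(sideDir k).re| = Real.pi / 2 := by
    fin_cases k <;> simp [sideDir] <;> positivity
  rw [this]
  linarith

lemma sz_norm_side (k : Fin 4) (t : ℝ) (ht : t ∈ Icc (0:ℝ) 1) :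
    ‖sideStart k + t * sideDir k‖ ≤ 5 := by
  have hpi := Real.pi_lt_d2
  have hpi0 := Real.pi_pos
  obtain ⟨h1, h2⟩ := sz_side k t
  refine (Complex.norm_le_abs_re_add_abs_im _).trans ?_
  rw [h1, h2, abs_mul, abs_mul, abs_of_pos (show 0 < Real.pi / 2 by positivity), ← add_mul]
  have : |![t, 1 + t, 2 - t, 1 - t] k| + |![-t, t - 1, t, 1 - t] k| ≤ 3 := by
    obtain ⟨h3, h4⟩ := ht
    fin_cases k <;> simp
    · rw [abs_of_nonneg h3]; linarith
    · rw [abs_of_nonneg (by linarith), abs_of_nonpos (by linarith)]; linarith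
    · rw [abs_of_nonneg (by linarith), abs_of_nonneg h3]; linarith
    · rw [abs_of_nonneg (by linarith)]; linarith
  nlinarith

lemma sz_avoid_right (k : Fin 4) (hk : k = 0 ∨ k = 3) (z : ℂ) (hz : z ∈ SectorDelta) (t : ℝ)
    (ht : t ∈ Icc (0:ℝ) 1) : sideStart k + t * sideDir k ≠ z := by
  rintro rfl
  have hpi0 := Real.pi_pos
  obtain ⟨h1, h2⟩ := sz_side k t
  rw [sz_memDelta, h1, h2, abs_lt] at hz
  obtain ⟨h3, h4⟩ := hz
  rcases hk with rfl | rfl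
  · simp at h3
  · simp at h4

lemma sz_avoid_left (k : Fin 4) (hk : k = 1 ∨ k = 2) (z : ℂ) (hz : z ∈ SectorPiDelta) (t : ℝ)
    (ht : t ∈ Icc (0:ℝ) 1) : sideStart k + t * sideDir k ≠ z := by
  rintro rfl
  have hpi0 := Real.pi_pos
  obtain ⟨h1, h2⟩ := sz_side k t
  rw [sz_memPiDelta, h1, h2, abs_lt] at hz
  obtain ⟨h3, h4⟩ := hz
  rcases hk with rfl | rfl
  · simp at h3
    nlinarith
  · simp at h4
    nlinarith

/-- The Cauchy integral of a boundary function of class `L log⁺ L` on `∂D`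
belongs to `A²(Δ) + A²(π − Δ)`.  In other words,
`E_{L log⁺ L}(D) ⊂ A²(Δ) + A²(π − Δ)`. -/
theorem smirnovZygmund_subset_sum_of_bergman_spaces
    (g : ℂ → ℂ) (hg : BoundaryIntegrable g) (hgLlogL : BoundaryLlogL g) :
    ∃ f₁ f₂ : ℂ → ℂ, MemA2 SectorDelta f₁ ∧ MemA2 SectorPiDelta f₂ ∧
      ∀ z ∈ SquareD, cauchyD g z = f₁ z + f₂ z := by
  have hrep := fun k : Fin 4 => sz_rep (sideStart k) (sideDir k)
    (norm_pos_iff.1 (lt_of_lt_of_le one_pos (sz_dir k))) (fun t => g (sidePath k t)) (hg k) (hgLlogL k)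
  choose φ hφ hi hl hF using hrep
  set κ : ℂ := (2 * (Real.pi : ℂ) * Complex.I)⁻¹ with hκ
  set c₁ : ℂ := szm (sideDir 0) (φ 0) + szm (sideDir 3) (φ 3) with hc₁
  set c₂ : ℂ := szm (sideDir 1) (φ 1) + szm (sideDir 2) (φ 2) with hc₂
  have hP1 : ∀ z ∈ SectorDelta, szP z := fun z hz => Or.inl ((sz_memDelta z).1 hz)
  have hP2 : ∀ z ∈ SectorPiDelta, szP z := fun z hz => Or.inr ((sz_memPiDelta z).1 hz)
  have hdiff : ∀ (α β z : ℂ), szP z → DifferentiableAt ℂ (fun z => α * szhp z + β * szhm z) z :=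
    fun α β z h => ((szhp_diff z h).const_mul α).add ((szhm_diff z h).const_mul β)
  have hbd : ∀ (α β x y : ℂ) (r : ℝ), ‖x‖ ≤ r → ‖y‖ ≤ r →
      ‖α * x + β * y‖ ≤ ‖α‖ * r + ‖β‖ * r := by
    intro α β x y r hx hy
    refine (norm_add_le _ _).trans ?_
    rw [norm_mul, norm_mul]
    gcongr
  refine ⟨fun z => κ * (szF (sideStart 0) (sideDir 0) (φ 0) z +
      szF (sideStart 3) (sideDir 3) (φ 3) z) + (κ * c₁ * szhp z + -(κ * c₂) * szhm z),
    fun z => κ * (szF (sideStart 1) (sideDir 1) (φ 1) z +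
      szF (sideStart 2) (sideDir 2) (φ 2) z) + (-(κ * c₁) * szhp z + κ * c₂ * szhm z), ?_, ?_, ?_⟩
  · refine sz_sector SectorDelta sz_measDelta
      _ _ (sz_dir 0) (sz_norm_side 0) (sz_avoid_right 0 (Or.inl rfl)) _ (hφ 0) (hi 0) (hl 0)
      _ _ (sz_dir 3) (sz_norm_side 3) (sz_avoid_right 3 (Or.inr rfl)) _ (hφ 3) (hi 3) (hl 3)
      κ (fun z => κ * c₁ * szhp z + -(κ * c₂) * szhm z)
      (fun z hz => (hdiff _ _ z (hP1 z hz)).differentiableWithinAt)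
      (‖κ * c₁‖ * 1 + ‖-(κ * c₂)‖ * 1) (‖κ * c₁‖ * 13 + ‖-(κ * c₂)‖ * 13) ?_ ?_
    · intro z hz
      have h := szh_bd z (hP1 z hz)
      exact hbd _ _ _ _ _ h.1 h.2
    · intro z hz hz1
      have h := szh_right z hz hz1
      have h2 := hbd (κ * c₁) (-(κ * c₂)) _ _ _ h.1 h.2
      have e : κ * c₁ * szhp z + -(κ * c₂) * szhm z - κ * c₁ / z =
          κ * c₁ * (szhp z - 1 / z) + -(κ * c₂) * szhm z := by ring
      show ‖κ * c₁ * szhp z + -(κ * c₂) * szhm z - κ * c₁ / z‖ ≤ _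
      rw [e]
      refine h2.trans (le_of_eq ?_)
      ring
  · refine sz_sector SectorPiDelta sz_measPiDelta
      _ _ (sz_dir 1) (sz_norm_side 1) (sz_avoid_left 1 (Or.inl rfl)) _ (hφ 1) (hi 1) (hl 1)
      _ _ (sz_dir 2) (sz_norm_side 2) (sz_avoid_left 2 (Or.inr rfl)) _ (hφ 2) (hi 2) (hl 2)
      κ (fun z => -(κ * c₁) * szhp z + κ * c₂ * szhm z)
      (fun z hz => (hdiff _ _ z (hP2 z hz)).differentiableWithinAt)
      (‖-(κ * c₁)‖ * 1 + ‖κ * c₂‖ * 1) (‖-(κ * c₁)‖ * 13 + ‖κ * c₂‖ * 13) ?_ ?_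
    · intro z hz
      have h := szh_bd z (hP2 z hz)
      exact hbd _ _ _ _ _ h.1 h.2
    · intro z hz hz1
      have h := szh_left z hz hz1
      have h2 := hbd (-(κ * c₁)) (κ * c₂) _ _ _ h.2 h.1
      have e : -(κ * c₁) * szhp z + κ * c₂ * szhm z - κ * c₂ / z =
          -(κ * c₁) * szhp z + κ * c₂ * (szhm z - 1 / z) := by ring
      show ‖-(κ * c₁) * szhp z + κ * c₂ * szhm z - κ * c₂ / z‖ ≤ _
      rw [e]
      refine h2.trans (le_of_eq ?_)
      ring
  · intro z hz
    have h0 := hF 0 z (sz_avoid_right 0 (Or.inl rfl) z hz.1)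
    have h3 := hF 3 z (sz_avoid_right 3 (Or.inr rfl) z hz.1)
    have h1 := hF 1 z (sz_avoid_left 1 (Or.inl rfl) z hz.2)
    have h2 := hF 2 z (sz_avoid_left 2 (Or.inr rfl) z hz.2)
    unfold cauchyD
    rw [Fin.sum_univ_four]
    have e : ∀ k t, sidePath k t - z = sideStart k + t * sideDir k - z := fun k t => rfl
    simp only [e]
    rw [h0, h1, h2, h3]
    ring

end
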